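/- Every nonzero Whitehead group A has a direct summand isomorphic to ℤ; in particular, Hom(A, ℤ) ≠ 0. -/

import Mathlib

open CategoryTheory

/-- `Ext1 A C` is the abelian group `Ext¹_ℤ(A, C)` (as a type), computed in the
category of `ℤ`-modules, i.e. abelian groups. -/
noncomputable abbrev Ext1 (A C : Type) [AddCommGroup A] [AddCommGroup C] : Type _ :=
  ((Ext ℤ (ModuleCat.{0} ℤ) 1).obj (Opposite.op (ModuleCat.of ℤ A))).obj (ModuleCat.of ℤ C)

/-- An abelian group `A` is a Whitehead group if `Ext¹_ℤ(A, ℤ) = 0`. -/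
def IsWhitehead (A : Type) [AddCommGroup A] : Prop := Subsingleton (Ext1 A ℤ)

/-- If `Ext¹(X, Y)` vanishes, every degree-one cocycle on a projective resolution of `X` with values
in `Y` is a coboundary. -/
lemma CategoryTheory.ProjectiveResolution.exists_d_comp_eq_of_subsingleton_ext
    {R C : Type*} [Ring R] [Category* C] [Abelian C] [Linear R C] [EnoughProjectives C] {X : C}
    (P : ProjectiveResolution X) (Y : C)
    [Subsingleton (((Ext R C 1).obj (Opposite.op X)).obj Y)]
    (χ : P.complex.X 1 ⟶ Y) (hχ : P.complex.d 2 1 ≫ χ = 0) :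
    ∃ θ : P.complex.X 0 ⟶ Y, P.complex.d 1 0 ≫ θ = χ := by
  have hz : Limits.IsZero (((Ext R C 1).obj (Opposite.op X)).obj Y) :=
    ModuleCat.isZero_of_subsingleton _
  have hz' := hz.of_iso (P.isoExt (R := R) 1 Y).symm
  rw [← HomologicalComplex.exactAt_iff_isZero_homology,
    HomologicalComplex.exactAt_iff' _ 0 1 2 (by simp) (by simp),
    ShortComplex.moduleCat_exact_iff] at hz'
  exact hz' χ hχ

namespace AddMonoidHom

variable {A : Type*} [AddCommGroup A]

/-- A homomorphism to `ℚ` that vanishes modulo `ℤ` comes from a homomorphism to `ℤ`. -/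
lemma exists_intCast_eq_of_coe_addCircle_eq_zero (f : A →+ ℚ)
    (hf : ∀ a, (f a : AddCircle (1 : ℚ)) = 0) : ∃ g : A →+ ℤ, ∀ a, (g a : ℚ) = f a := by
  have h (a : A) : ∃ n : ℤ, (n : ℚ) = f a := by
    simpa using (AddCircle.coe_eq_zero_iff (1 : ℚ)).1 (hf a)
  choose g hg using h
  exact ⟨AddMonoidHom.mk' g fun a b ↦ by
    have := hg (a + b)
    rw [map_add, ← hg a, ← hg b] at this
    exact_mod_cast this, hg⟩

/-- A nonzero homomorphism to `ℤ` splits off a direct summand isomorphic to `ℤ`. -/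
lemma exists_isCompl_addEquiv_int {f : A →+ ℤ} (hf : f ≠ 0) :
    ∃ S T : AddSubgroup A, IsCompl S T ∧ Nonempty (S ≃+ ℤ) := by
  obtain ⟨d, hd⟩ := Int.subgroup_cyclic f.range
  have hdvd (a : A) : d ∣ f a := by
    have : f a ∈ f.range := ⟨a, rfl⟩
    rw [hd] at this
    simpa [Int.mem_zmultiples_iff, ← AddSubgroup.zmultiples_eq_closure] using this
  obtain ⟨s, hs⟩ : d ∈ f.range := hd ▸ AddSubgroup.subset_closure rfl
  have hd0 : d ≠ 0 := by
    rintro rfl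
    exact hf (AddMonoidHom.ext fun a ↦ by simpa using hdvd a)
  have hmul (n : ℤ) : f (n • s) = n * d := by simp [hs]
  refine ⟨AddSubgroup.zmultiples s, f.ker, ⟨?_, ?_⟩, ?_⟩
  · rw [AddSubgroup.disjoint_def]
    rintro _ ⟨n, rfl⟩ h
    have : n * d = 0 := by rw [← hmul]; exact h
    simp [(mul_eq_zero.1 this).resolve_right hd0]
  · rw [codisjoint_iff, eq_top_iff]
    intro a _
    obtain ⟨n, hn⟩ := hdvd a
    refine AddSubgroup.mem_sup.2 ⟨n • s, ⟨n, rfl⟩, a - n • s, ?_, by abel⟩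
    rw [AddMonoidHom.mem_ker, map_sub, hmul, hn]
    ring
  · have hinj : Function.Injective (zmultiplesHom A s) := by
      rw [injective_iff_map_eq_zero]
      intro n hn
      have : n * d = 0 := by rw [← hmul]; simpa using congrArg f hn
      exact (mul_eq_zero.1 this).resolve_right hd0
    exact ⟨(AddMonoidHom.ofInjective hinj).symm⟩

end AddMonoidHom

/-- Characters separate points from subgroups. -/
lemma AddSubgroup.exists_character_apply_ne_zero {A : Type*} [AddCommGroup A] (H : AddSubgroup A)
    {x : A} (hx : x ∉ H) :
    ∃ φ : A →+ AddCircle (1 : ℚ), (∀ h ∈ H, φ h = 0) ∧ φ x ≠ 0 := by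
  obtain ⟨c, hc⟩ := CharacterModule.exists_character_apply_ne_zero_of_ne_zero
    (a := (x : A ⧸ H)) (by simpa [QuotientAddGroup.eq_zero_iff] using hx)
  refine ⟨AddMonoidHom.comp c (QuotientAddGroup.mk' H), fun h hh ↦ ?_, hc⟩
  change c (h : A ⧸ H) = 0
  rw [(QuotientAddGroup.eq_zero_iff h).2 hh]
  exact map_zero c

namespace IsWhitehead

variable {A : Type} [AddCommGroup A]

/-- Every character of a Whitehead group lifts to `ℚ`. -/
lemma exists_lift_character (hA : IsWhitehead A) (φ : A →+ AddCircle (1 : ℚ)) :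
    ∃ f : A →+ ℚ, ∀ a, (f a : AddCircle (1 : ℚ)) = φ a := by
  have : Subsingleton (((Ext ℤ (ModuleCat.{0} ℤ) 1).obj
    (Opposite.op (ModuleCat.of ℤ A))).obj (ModuleCat.of ℤ ℤ)) := hA
  let P := projectiveResolution (ModuleCat.of ℤ A)
  let d : P.complex.X 1 →ₗ[ℤ] P.complex.X 0 := (P.complex.d 1 0).hom
  let ε : P.complex.X 0 →ₗ[ℤ] A := (P.π.f 0).hom
  have hε : Function.Surjective ε :=
    (ModuleCat.epi_iff_surjective (P.π.f 0)).1 inferInstance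
  have hex : LinearMap.range d = LinearMap.ker ε := P.exact₀.moduleCat_range_eq_ker
  have hεd (y) : ε (d y) = 0 := LinearMap.mem_ker.1 (hex ▸ ⟨y, rfl⟩)
  have : Module.Projective ℤ (P.complex.X 0) :=
    (IsProjective.iff_projective (P.complex.X 0)).2 (P.projective 0)
  let q : ℚ →+ AddCircle (1 : ℚ) := QuotientAddGroup.mk' _
  have hq : Function.Surjective q := QuotientAddGroup.mk'_surjective _
  obtain ⟨ψ, hψ⟩ := Module.projective_lifting_property q.toIntLinearMap
    (φ.toIntLinearMap ∘ₗ ε) hq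
  have hψ' (x) : (ψ x : AddCircle (1 : ℚ)) = φ (ε x) := LinearMap.congr_fun hψ x
  obtain ⟨χ, hχ⟩ := (ψ ∘ₗ d).toAddMonoidHom.exists_intCast_eq_of_coe_addCircle_eq_zero
    fun y ↦ (hψ' (d y)).trans (by rw [hεd, map_zero])
  replace hχ (y) : (χ y : ℚ) = ψ (d y) := hχ y
  let χ' : P.complex.X 1 →ₗ[ℤ] ℤ :=
    { χ with
      map_smul' := fun n y ↦ map_intCast_smul χ ℤ ℤ n y }
  obtain ⟨θ, hθ⟩ := P.exists_d_comp_eq_of_subsingleton_ext (R := ℤ) (ModuleCat.of ℤ ℤ)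
    (ModuleCat.ofHom χ') (by
      ext z
      have hdd : d ((P.complex.d 2 1).hom z) = 0 :=
        LinearMap.congr_fun (congrArg ModuleCat.Hom.hom (P.complex.d_comp_d 2 1 0)) z
      have h := hχ ((P.complex.d 2 1).hom z)
      rw [hdd, map_zero] at h
      exact_mod_cast h)
  have hθ' (y) : θ.hom (d y) = χ y := LinearMap.congr_fun (congrArg ModuleCat.Hom.hom hθ) y
  let g : P.complex.X 0 →ₗ[ℤ] ℚ := ψ - (Int.castAddHom ℚ).toIntLinearMap ∘ₗ θ.hom
  have hg (x) : g x = ψ x - (θ.hom x : ℤ) := rfl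
  have hker : LinearMap.ker ε ≤ LinearMap.ker g := by
    rw [← hex]
    rintro _ ⟨y, rfl⟩
    rw [LinearMap.mem_ker, hg, hθ', hχ, sub_self]
  let f : A →+ ℚ := ε.toAddMonoidHom.liftOfSurjective hε ⟨g.toAddMonoidHom, hker⟩
  refine ⟨f, fun a ↦ ?_⟩
  obtain ⟨x, rfl⟩ := hε a
  have hf : f (ε x) = g x :=
    ε.toAddMonoidHom.liftOfRightInverse_comp_apply _ _ ⟨g.toAddMonoidHom, hker⟩ x
  have hθx : (((θ.hom x : ℤ) : ℚ) : AddCircle (1 : ℚ)) = 0 :=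
    (AddCircle.coe_eq_zero_iff (1 : ℚ)).2 ⟨θ.hom x, by simp⟩
  rw [hf, hg, AddCircle.coe_sub, hθx, sub_zero, hψ']

lemma eq_zero_of_zsmul_eq_zero (hA : IsWhitehead A) {n : ℤ} (hn : n ≠ 0) {a : A}
    (h : n • a = 0) : a = 0 := by
  refine CharacterModule.eq_zero_of_character_apply fun φ ↦ ?_
  obtain ⟨f, hf⟩ := hA.exists_lift_character φ
  have hfa : f a = 0 := by
    have := congrArg f h
    simpa [hn] using this
  exact (hf a).symm.trans (by rw [hfa]; rfl)

/-- A Whitehead group without nonzero homomorphisms to `ℤ` is divisible. -/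
lemma exists_zsmul_eq (hA : IsWhitehead A) (hZ : ∀ f : A →+ ℤ, f = 0) {n : ℤ} (hn : n ≠ 0)
    (a : A) : ∃ b, n • b = a := by
  by_contra hna
  obtain ⟨φ, hφ, hφa⟩ := (zsmulAddGroupHom (α := A) n).range.exists_character_apply_ne_zero
    (x := a) hna
  obtain ⟨f, hf⟩ := hA.exists_lift_character φ
  obtain ⟨g, hg⟩ := (n • f).exists_intCast_eq_of_coe_addCircle_eq_zero fun b ↦ by
    rw [AddMonoidHom.smul_apply, ← map_zsmul, hf]
    exact hφ _ ⟨b, rfl⟩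
  have h := hg a
  rw [hZ g] at h
  have hfa : f a = 0 := by simpa [hn] using h.symm
  exact hφa ((hf a).symm.trans (by rw [hfa]; rfl))

/-- A nonzero Whitehead group has a nonzero homomorphism to `ℤ`. -/
lemma exists_addMonoidHom_int_ne_zero [Nontrivial A] (hA : IsWhitehead A) :
    ∃ f : A →+ ℤ, f ≠ 0 := by
  by_contra! hZ
  obtain ⟨a, ha⟩ := exists_ne (0 : A)
  obtain ⟨x, hx⟩ := hA.exists_zsmul_eq hZ two_ne_zero a
  -- A character trivial on `ℤ[1/3] a` but not at `a / 2` has no lift to `ℚ`.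
  let H : AddSubgroup A :=
    { carrier := {b | ∃ (k : ℕ) (m : ℤ), (3 ^ k : ℤ) • b = m • a}
      zero_mem' := ⟨0, 0, by simp⟩
      add_mem' := by
        rintro b c ⟨k, m, hb⟩ ⟨l, n, hc⟩
        refine ⟨k + l, 3 ^ l * m + 3 ^ k * n, ?_⟩
        rw [smul_add, add_smul, mul_smul, mul_smul, ← hb, ← hc, smul_smul, smul_smul,
          pow_add, mul_comm ((3 : ℤ) ^ l)]
      neg_mem' := by
        rintro b ⟨k, m, hb⟩
        exact ⟨k, -m, by rw [smul_neg, hb, neg_smul]⟩ }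
  have hxH : x ∉ H := by
    rintro ⟨k, m, h⟩
    refine ha (hA.eq_zero_of_zsmul_eq_zero (n := 3 ^ k - 2 * m) ?_ ?_)
    · have : Odd ((3 : ℤ) ^ k) := Odd.pow (by decide)
      rcases this with ⟨r, hr⟩
      omega
    · rw [sub_smul, mul_smul, ← h, ← hx, smul_comm, sub_self]
  obtain ⟨φ, hφ, hφx⟩ := H.exists_character_apply_ne_zero hxH
  obtain ⟨f, hf⟩ := hA.exists_lift_character φ
  have hH (b : A) (hb : b ∈ H) : ∃ n : ℤ, (n : ℚ) = f b := by
    simpa using (AddCircle.coe_eq_zero_iff (1 : ℚ)).1 ((hf b).trans (hφ b hb))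
  obtain ⟨n, hn⟩ := hH a ⟨0, 1, by simp⟩
  have hdvd (k : ℕ) : (3 : ℤ) ^ k ∣ n := by
    obtain ⟨b, hb⟩ := hA.exists_zsmul_eq hZ (n := 3 ^ k) (by positivity) a
    obtain ⟨m, hm⟩ := hH b ⟨k, 1, by rw [hb, one_smul]⟩
    refine ⟨m, ?_⟩
    have h := congrArg f hb
    rw [map_zsmul, ← hn, ← hm, zsmul_eq_mul] at h
    exact_mod_cast h.symm
  have hn0 : n = 0 := by
    refine Int.eq_zero_of_abs_lt_dvd (hdvd n.natAbs) ?_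
    rw [Int.abs_eq_natAbs]
    exact_mod_cast Nat.lt_pow_self (by norm_num : 1 < 3)
  have hfx : f x = 0 := by
    have h := congrArg f hx
    rw [map_zsmul, ← hn, hn0] at h
    simpa using h
  exact hφx ((hf x).symm.trans (by rw [hfx]; rfl))

end IsWhitehead

/-- Every nonzero Whitehead group has a direct summand isomorphic to `ℤ`;
in particular `Hom(A, ℤ) ≠ 0`. -/
theorem whitehead_has_Z_summand (A : Type) [AddCommGroup A] (hA : IsWhitehead A)
    (h0 : Nontrivial A) :
    (∃ S T : AddSubgroup A, IsCompl S T ∧ Nonempty (S ≃+ ℤ)) ∧ (∃ f : A →+ ℤ, f ≠ 0) := by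
  obtain ⟨f, hf⟩ := hA.exists_addMonoidHom_int_ne_zero
  exact ⟨f.exists_isCompl_addEquiv_int hf, f, hf⟩
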